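/- Moment inequality for commuting positive operators (N = 2 case of Prop. 8 with p = 2): let A₁,…,A_M and B₁,…,B_M be positive semidefinite operators on finite-dimensional Hilbert spaces H_A and H_B respectively, and let ρ be a density matrix on H_A ⊗ H_B. Then (∑_{k=1}^M tr[(A_k ⊗ B_k) ρ])² ≤ ∑_{k,l=1}^M tr[(A_k² ⊗ B_l²) ρ]. -/

import Mathlib

open scoped ComplexOrder Kronecker

section helpers

theorem aux_le_of_sq_le {R : Type*} [CStarAlgebra R] [PartialOrder R] [StarOrderedRing R]
    (T Z : R) (hT : IsSelfAdjoint T) (hZ : 0 ≤ Z) (h : T * T ≤ Z * Z) : T ≤ Z := by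
  have h1 : CFC.abs T ≤ Z := by
    have h2 := CFC.sqrt_le_sqrt _ _ h
    rw [CFC.sqrt_mul_self Z hZ] at h2
    have h3 : CFC.abs T = CFC.sqrt (T * T) := by
      rw [CFC.abs, hT.star_eq]
    rw [h3]; exact h2
  have h4 : T ≤ CFC.abs T := by
    have h5 := CFC.abs_sub_self T hT
    rw [← sub_nonneg, h5]
    exact nsmul_nonneg (CFC.negPart_nonneg T) 2
  exact h4.trans h1

theorem aux_sum_le {R ι : Type*} [CStarAlgebra R] [PartialOrder R] [StarOrderedRing R]
    [Fintype ι] (a b : ι → R) (p J q e : R)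
    (ha : ∀ k, star (a k) = a k) (hb : ∀ k, star (b k) = b k)
    (hab : ∀ k, b k * a k = a k * b k)
    (hp : star p = p) (hJ : star J = J) (hJp : J * p = 1) (hpJ : p * J = 1)
    (hJq : q * J = J * q) (hZ : 0 ≤ J * q) (he : 0 ≤ e)
    (hpp : p * p = ∑ k, a k * a k + e) (hqq : q * q = ∑ k, b k * b k) :
    ∑ k, a k * b k ≤ q * p := by
  set S := ∑ k, a k * b k with hS
  have hSs : star S = S := by
    rw [hS, star_sum]
    exact Finset.sum_congr rfl fun k _ => by rw [star_mul, ha, hb, hab]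
  set T := J * S * J with hT
  have hTs : star T = T := by simp only [hT, star_mul, hJ, hSs, mul_assoc]
  set Q := J * J * S * J with hR
  have hQs : star Q = J * S * J * J := by simp only [hR, star_mul, hJ, hSs, mul_assoc]
  have hsum : 0 ≤ ∑ k, star (a k * Q - b k * J) * (a k * Q - b k * J) :=
    Finset.sum_nonneg fun k _ => star_mul_self_nonneg _
  have hexp : ∑ k, star (a k * Q - b k * J) * (a k * Q - b k * J)
      = star Q * (∑ k, a k * a k) * Q - star Q * S * J - J * S * Q
        + J * (∑ k, b k * b k) * J := by
    rw [hS]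
    simp only [Finset.mul_sum, Finset.sum_mul, ← Finset.sum_sub_distrib,
      ← Finset.sum_add_distrib]
    refine Finset.sum_congr rfl fun k _ => ?_
    rw [star_sub, star_mul (a k) Q, star_mul (b k) J, ha, hb, hJ, ← hab]
    have : star Q * (b k * a k) * J = star Q * a k * b k * J := by rw [hab]; noncomm_ring
    rw [this]
    noncomm_ring
  have e1 : ∑ k, a k * a k = p * p - e := by rw [hpp]; simp
  have e2 : star Q * (p * p) * Q = T * T := by
    calc star Q * (p * p) * Q = J * S * J * (J * p) * (p * J) * J * S * J := by
          rw [hQs, hR]; noncomm_ring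
      _ = T * T := by rw [hJp, hpJ, hT]; noncomm_ring
  have e3 : star Q * S * J = T * T := by rw [hQs, hT]; noncomm_ring
  have e4 : J * S * Q = T * T := by rw [hR, hT]; noncomm_ring
  have e5 : J * (∑ k, b k * b k) * J = (J * q) * (J * q) := by
    rw [← hqq]
    calc J * (q * q) * J = J * q * (q * J) := by noncomm_ring
      _ = _ := by rw [hJq]
  have e6 : 0 ≤ star Q * e * Q := star_left_conjugate_nonneg he Q
  rw [hexp, e1, mul_sub, sub_mul, e2, e3, e4, e5] at hsum
  have hle : T * T ≤ (J * q) * (J * q) := by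
    rw [← sub_nonneg]
    have := add_nonneg hsum e6
    convert this using 1
    abel
  have hTZ := aux_le_of_sq_le T (J * q) hTs hZ hle
  have := IsSelfAdjoint.conjugate_le_conjugate hTZ (c := p) hp
  have f1 : p * T * p = S := by
    calc p * T * p = (p * J) * S * (J * p) := by rw [hT]; noncomm_ring
      _ = S := by rw [hJp, hpJ]; simp
  have f2 : p * (J * q) * p = q * p := by rw [← mul_assoc p, hpJ, one_mul]
  rwa [f1, f2] at this

open scoped MatrixOrder in
theorem aux_tr_nonneg {N : Type*} [Fintype N] [DecidableEq N] {X ρ : Matrix N N ℂ}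
    (hX : X.PosSemidef) (hρ : ρ.PosSemidef) : 0 ≤ (X * ρ).trace.re := by
  obtain ⟨C, rfl⟩ := CStarAlgebra.nonneg_iff_eq_star_mul_self.mp hρ.nonneg
  rw [Matrix.star_eq_conjTranspose]
  rw [← mul_assoc, Matrix.trace_mul_comm, ← mul_assoc]
  exact (Complex.le_def.mp (hX.mul_mul_conjTranspose_same C).trace_nonneg).1

theorem aux_var {N : Type*} [Fintype N] [DecidableEq N] {W ρ : Matrix N N ℂ}
    (hW : W.IsHermitian) (hρ : ρ.PosSemidef) (h1 : ρ.trace = 1) :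
    ((W * ρ).trace.re) ^ 2 ≤ (W * W * ρ).trace.re := by
  set c : ℝ := (W * ρ).trace.re with hc
  have h := aux_tr_nonneg (Matrix.posSemidef_conjTranspose_mul_self
    (W - (c : ℂ) • (1 : Matrix N N ℂ))) hρ
  have h2 : (W - (c : ℂ) • (1 : Matrix N N ℂ)).conjTranspose * (W - (c : ℂ) • 1) * ρ
      = W * W * ρ - (2 * c : ℂ) • (W * ρ) + (c * c : ℂ) • ρ := by
    rw [Matrix.conjTranspose_sub, hW.eq, Matrix.conjTranspose_smul, Matrix.conjTranspose_one]
    simp only [sub_mul, mul_sub, Matrix.smul_mul, Matrix.mul_smul, one_mul, mul_one,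
      Complex.star_def, Complex.conj_ofReal, two_mul, add_smul, mul_smul]
    abel
  rw [h2, Matrix.trace_add, Matrix.trace_sub, Matrix.trace_smul, Matrix.trace_smul, h1] at h
  simp [← hc] at h
  nlinarith

open scoped MatrixOrder Matrix.Norms.L2Operator in
theorem aux_eps
    (M : ℕ) {n m : Type*} [Fintype n] [DecidableEq n] [Fintype m] [DecidableEq m]
    (A : Fin M → Matrix n n ℂ) (B : Fin M → Matrix m m ℂ)
    (hA : ∀ k, (A k).PosSemidef) (hB : ∀ k, (B k).PosSemidef) (ε : ℝ) (hε : 0 < ε) :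
    ∃ W : Matrix (n × m) (n × m) ℂ, W.IsHermitian ∧
      (W - ∑ k, A k ⊗ₖ B k).PosSemidef ∧
      W * W = (∑ k, A k ^ 2 + (ε : ℂ) • 1) ⊗ₖ (∑ k, B k ^ 2) := by
  have hsqA : (∑ k, A k ^ 2).PosSemidef :=
    Matrix.posSemidef_sum _ fun k _ => (hA k).pow 2
  have hsqB : (∑ k, B k ^ 2).PosSemidef :=
    Matrix.posSemidef_sum _ fun k _ => (hB k).pow 2
  have hεc : (0 : ℂ) < (ε : ℂ) := by exact_mod_cast hε
  have hE : ((ε : ℂ) • (1 : Matrix n n ℂ)).PosDef := Matrix.PosDef.one.smul hεc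
  have hP : (∑ k, A k ^ 2 + (ε : ℂ) • 1).PosDef := Matrix.PosDef.posSemidef_add hsqA hE
  set P := ∑ k, A k ^ 2 + (ε : ℂ) • (1 : Matrix n n ℂ) with hPdef
  set Q := ∑ k, B k ^ 2 with hQdef
  set p := CFC.sqrt P
  set q := CFC.sqrt Q
  have hpp : p * p = P := CFC.sqrt_mul_sqrt_self P hP.posSemidef.nonneg
  have hqq : q * q = Q := CFC.sqrt_mul_sqrt_self Q hsqB.nonneg
  have hp0 : p.PosSemidef := Matrix.nonneg_iff_posSemidef.mp (CFC.sqrt_nonneg P)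
  have hq0 : q.PosSemidef := Matrix.nonneg_iff_posSemidef.mp (CFC.sqrt_nonneg Q)
  have hdet : IsUnit p.det := by
    have : IsUnit (p * p).det := by
      rw [hpp]; exact (Matrix.isUnit_iff_isUnit_det _).mp hP.isUnit
    rw [Matrix.det_mul] at this
    exact isUnit_of_mul_isUnit_left this
  have hJ0 : p⁻¹.PosSemidef := hp0.inv
  have key := aux_sum_le (R := Matrix (n × m) (n × m) ℂ)
    (fun k => A k ⊗ₖ (1 : Matrix m m ℂ)) (fun k => (1 : Matrix n n ℂ) ⊗ₖ B k)
    (p ⊗ₖ 1) (p⁻¹ ⊗ₖ 1) (1 ⊗ₖ q) (((ε : ℂ) • 1) ⊗ₖ 1)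
    (fun k => by
      rw [Matrix.star_eq_conjTranspose, Matrix.conjTranspose_kronecker, (hA k).1.eq,
        Matrix.conjTranspose_one])
    (fun k => by
      rw [Matrix.star_eq_conjTranspose, Matrix.conjTranspose_kronecker, (hB k).1.eq,
        Matrix.conjTranspose_one])
    (fun k => by simp only [← Matrix.mul_kronecker_mul, one_mul, mul_one])
    (by rw [Matrix.star_eq_conjTranspose, Matrix.conjTranspose_kronecker, hp0.1.eq,
        Matrix.conjTranspose_one])
    (by rw [Matrix.star_eq_conjTranspose, Matrix.conjTranspose_kronecker, hJ0.1.eq,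
        Matrix.conjTranspose_one])
    (by rw [← Matrix.mul_kronecker_mul, Matrix.nonsing_inv_mul _ hdet, one_mul,
        Matrix.one_kronecker_one])
    (by rw [← Matrix.mul_kronecker_mul, Matrix.mul_nonsing_inv _ hdet, one_mul,
        Matrix.one_kronecker_one])
    (by simp only [← Matrix.mul_kronecker_mul, one_mul, mul_one])
    (by
      rw [← Matrix.mul_kronecker_mul, one_mul, mul_one]
      exact (hJ0.kronecker hq0).nonneg)
    ((hE.posSemidef.kronecker Matrix.PosSemidef.one).nonneg)
    (by
      simp only [← Matrix.mul_kronecker_mul, one_mul, hpp, hPdef, Matrix.add_kronecker, pow_two]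
      congr 1
      ext ⟨i, j⟩ ⟨i2, j2⟩
      simp [Matrix.sum_apply, Finset.sum_mul])
    (by
      simp only [← Matrix.mul_kronecker_mul, one_mul, hqq, hQdef, pow_two]
      ext ⟨i, j⟩ ⟨i2, j2⟩
      simp [Matrix.sum_apply, Finset.mul_sum])
  simp only [← Matrix.mul_kronecker_mul, one_mul, mul_one] at key
  refine ⟨p ⊗ₖ q, ?_, Matrix.le_iff.mp key, ?_⟩
  · exact (hp0.kronecker hq0).1
  · rw [← Matrix.mul_kronecker_mul, hpp, hqq]

end helpers




/-- Moment inequality for a bipartite quantum state (`N = 2`, `p = 2` case):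
`(∑ₖ tr[(Aₖ ⊗ Bₖ) ρ])² ≤ ∑ₖₗ tr[(Aₖ² ⊗ Bₗ²) ρ]` for positive semidefinite `Aₖ, Bₗ`
and a density matrix `ρ` on the tensor product space. -/
theorem moment_inequality_bipartite
    (M : ℕ) {n m : Type*} [Fintype n] [DecidableEq n] [Fintype m] [DecidableEq m]
    (A : Fin M → Matrix n n ℂ) (B : Fin M → Matrix m m ℂ)
    (hA : ∀ k, (A k).PosSemidef) (hB : ∀ k, (B k).PosSemidef)
    (ρ : Matrix (n × m) (n × m) ℂ) (hρ : ρ.PosSemidef) (hρ1 : ρ.trace = 1) :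
    (∑ k, ((A k ⊗ₖ B k) * ρ).trace.re) ^ 2
      ≤ ∑ k, ∑ l, (((A k ^ 2) ⊗ₖ (B l ^ 2)) * ρ).trace.re := by

  have hsum : ∑ k, ((A k ⊗ₖ B k) * ρ).trace.re = ((∑ k, A k ⊗ₖ B k) * ρ).trace.re := by
    rw [Finset.sum_mul, Matrix.trace_sum, Complex.re_sum]
  have hR : ∑ k, ∑ l, (((A k ^ 2) ⊗ₖ (B l ^ 2)) * ρ).trace.re
      = (((∑ k, A k ^ 2) ⊗ₖ (∑ l, B l ^ 2)) * ρ).trace.re := by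
    have : (∑ k, A k ^ 2) ⊗ₖ (∑ l, B l ^ 2) = ∑ k, ∑ l, (A k ^ 2) ⊗ₖ (B l ^ 2) := by
      ext ⟨i, j⟩ ⟨i2, j2⟩
      simp [Matrix.sum_apply, Finset.sum_mul_sum]
    rw [this]
    simp only [Finset.sum_mul, Matrix.trace_sum, Complex.re_sum]
  have hnn : 0 ≤ ∑ k, ((A k ⊗ₖ B k) * ρ).trace.re :=
    Finset.sum_nonneg fun k _ => aux_tr_nonneg ((hA k).kronecker (hB k)) hρ
  set c := (((1 : Matrix n n ℂ) ⊗ₖ (∑ l, B l ^ 2)) * ρ).trace.re with hc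
  have hc0 : 0 ≤ c := aux_tr_nonneg (Matrix.PosSemidef.one.kronecker
    (Matrix.posSemidef_sum _ fun k _ => (hB k).pow 2)) hρ
  have main : ∀ ε : ℝ, 0 < ε → (∑ k, ((A k ⊗ₖ B k) * ρ).trace.re) ^ 2
      ≤ ∑ k, ∑ l, (((A k ^ 2) ⊗ₖ (B l ^ 2)) * ρ).trace.re + ε * c := by
    intro ε hε
    obtain ⟨W, hW, hWS, hWW⟩ := aux_eps M A B hA hB ε hε
    have h1 := aux_tr_nonneg hWS hρ
    rw [sub_mul, Matrix.trace_sub, Complex.sub_re, ← hsum] at h1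
    have h2 := aux_var hW hρ hρ1
    rw [hWW, Matrix.add_kronecker, add_mul, Matrix.trace_add, Complex.add_re, ← hR,
      Matrix.smul_kronecker, Matrix.smul_mul, Matrix.trace_smul, smul_eq_mul,
      Complex.re_ofReal_mul, ← hc] at h2
    refine le_trans ?_ h2
    exact pow_le_pow_left₀ hnn (by linarith) 2
  refine le_of_forall_pos_le_add fun δ hδ => ?_
  have h := main (δ / (c + 1)) (by positivity)
  refine h.trans ?_
  have : δ / (c + 1) * c ≤ δ := by
    rw [div_mul_eq_mul_div, div_le_iff₀ (by positivity)]
    nlinarith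
  linarith
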